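/- Let 2≤r<n and let H=[h_{i,j}] be an r×n matrix over R=𝔽₂[x]/⟨x^m+1⟩ with h_{0,j}=1 for all 0≤j<n, such that: (1) for every choice of r column indices of H the determinant of the resulting r×r submatrix is coprime with f_{p,τ}(x) in 𝔽₂[x]; (2') for all 1≤i<r and all 0≤j,k<n with j≠k, either gcd(h_{i,j}, x^m+1) = x^τ+1 or gcd(h_{i,j}+h_{i,k}, x^m+1) = x^τ+1. Then for every choice of r block-column indices, the r(m−τ)×r(m−τ) submatrix of 𝒯_{r,n,m}(H) consisting of those block columns is invertible over 𝔽₂; i.e., V-ETBR(n,r,m,H) is a binary MDS array code. -/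

import Mathlib

open Polynomial

/-- The `(m-τ) × (m-τ)` binary matrix `𝒜_{τ,τ}(a)`: the top-left submatrix of the
`m × m` circulant matrix of `a` obtained by deleting the last `τ` rows and columns. -/
noncomputable def Att (m τ : ℕ) (a : Polynomial (ZMod 2)) :
    Matrix (Fin (m - τ)) (Fin (m - τ)) (ZMod 2) :=
  Matrix.of fun i j => a.coeff ((j.1 + (m - i.1)) % m)

/-- The block matrix `𝒯(B) = [𝒜_{τ,τ}(b_{i,j})]`. -/
noncomputable def Tmap {I J : Type*} (m τ : ℕ)
    (B : Matrix I J (Polynomial (ZMod 2))) :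
    Matrix (I × Fin (m - τ)) (J × Fin (m - τ)) (ZMod 2) :=
  Matrix.of fun r c => Att m τ (B r.1 c.1) r.2 c.2

/-- `f_{p,τ}(x) = 1 + x^τ + ⋯ + x^{(p-1)τ}` over `𝔽₂`. -/
noncomputable def fpoly (p τ : ℕ) : Polynomial (ZMod 2) :=
  ∑ i ∈ Finset.range p, Polynomial.X ^ (i * τ)

theorem pow_mul_map_eq_sum {R S : Type*} [Semiring R] [CommSemiring S] (F : R[X] →+* S) {m k : ℕ}
    (hk : k < m) (hF : F X ^ m = 1) {a : R[X]} (ha : a.degree < (m : WithBot ℕ)) :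
    F X ^ k * F a =
      ∑ t ∈ Finset.range m, F (C (a.coeff ((t + (m - k)) % m))) * F X ^ t := by
  have hm : 0 < m := by omega
  have ha' : F a = ∑ u ∈ Finset.range m, F (C (a.coeff u)) * F X ^ u := by
    rcases eq_or_ne a 0 with rfl | h0
    · simp
    · conv_lhs => rw [a.as_sum_range' m ((natDegree_lt_iff_degree_lt h0).2 ha)]
      simp [← C_mul_X_pow_eq_monomial]
  rw [ha', Finset.mul_sum]
  refine Finset.sum_nbij' (fun u => (u + k) % m) (fun t => (t + (m - k)) % m) ?_ ?_ ?_ ?_ ?_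
  · intro u _
    simpa using Nat.mod_lt _ hm
  · intro u _
    simpa using Nat.mod_lt _ hm
  · intro u hu
    have hu' : u < m := by simpa using hu
    simp only [Nat.mod_add_mod]
    rw [show u + k + (m - k) = u + m by omega, Nat.add_mod_right, Nat.mod_eq_of_lt hu']
  · intro t ht
    have ht' : t < m := by simpa using ht
    simp only [Nat.mod_add_mod]
    rw [show t + (m - k) + k = t + m by omega, Nat.add_mod_right, Nat.mod_eq_of_lt ht']
  · intro u hu
    have hu' : u < m := by simpa using hu
    simp only [Nat.mod_add_mod]
    rw [show u + k + (m - k) = u + m by omega, Nat.add_mod_right, Nat.mod_eq_of_lt hu',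
      ← pow_eq_pow_mod _ hF, pow_add]
    ring

theorem X_pow_add_one_eq_sub_one (k : ℕ) : (X ^ k + 1 : (ZMod 2)[X]) = X ^ k - 1 :=
  (CharTwo.sub_eq_add _ _).symm

theorem fpoly_mul_X_pow_add_one (p τ : ℕ) :
    fpoly p τ * (X ^ τ + 1) = X ^ (p * τ) + 1 := by
  rw [X_pow_add_one_eq_sub_one, X_pow_add_one_eq_sub_one, mul_comm p τ, pow_mul,
    ← geom_sum_mul (X ^ τ)]
  simp only [fpoly, ← pow_mul, mul_comm]

theorem degree_X_pow_add_one {k : ℕ} (hk : 0 < k) :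
    (X ^ k + 1 : (ZMod 2)[X]).degree = k := by
  simpa using degree_X_pow_add_C hk (1 : ZMod 2)

theorem degree_fpoly {p τ : ℕ} (hp : 0 < p) (hτ : 0 < τ) :
    (fpoly p τ).degree = ((p * τ - τ : ℕ) : WithBot ℕ) := by
  have h := congrArg degree (fpoly_mul_X_pow_add_one p τ)
  rw [degree_mul, degree_X_pow_add_one hτ, degree_X_pow_add_one (by positivity)] at h
  have h0 : fpoly p τ ≠ 0 := by
    intro h0
    rw [h0, degree_zero, WithBot.bot_add] at h
    exact WithBot.coe_ne_bot h.symm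
  rw [degree_eq_natDegree h0] at h ⊢
  norm_cast at h ⊢
  omega

theorem dvd_sub_of_forall_dvd_or_dvd_add {R ι : Type*} [CommRing R] {g : R} {h : ι → R}
    (hg : ∀ j k, j ≠ k → g ∣ h j ∨ g ∣ h j + h k) [CharP R 2] (j k : ι) :
    g ∣ h j - h k := by
  rcases eq_or_ne j k with rfl | hjk
  · simp
  rcases hg j k hjk with h1 | h1
  · rcases hg k j hjk.symm with h2 | h2
    · exact dvd_sub h1 h2
    · rwa [CharTwo.sub_eq_add, add_comm]
  · rwa [CharTwo.sub_eq_add]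

theorem dvd_of_dvd_vecMul_of_isCoprime_det {R ι : Type*} [CommRing R] [Fintype ι] [DecidableEq ι]
    {A : Matrix ι ι R} {f : R} (hA : IsCoprime A.det f) {u : ι → R}
    (hu : ∀ j, f ∣ Matrix.vecMul u A j) (i : ι) : f ∣ u i := by
  refine hA.symm.dvd_of_dvd_mul_left ?_
  have h : Matrix.vecMul (Matrix.vecMul u A) A.adjugate i = A.det * u i := by
    rw [Matrix.vecMul_vecMul, Matrix.mul_adjugate, Matrix.vecMul_smul, Matrix.vecMul_one]
    rfl
  rw [← h]
  exact Finset.dvd_sum fun j _ => (hu j).mul_right _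

/-- If the row vector `v` lies in the left kernel of `𝒯(A)`, then the product of the polynomial
vector of `v` with each column of `A` is, modulo `x^m + 1`, supported in the top `τ` degrees. -/
theorem exists_X_pow_mul_of_vecMul_Tmap_eq_zero {I J : Type*} [Fintype I] {m τ : ℕ}
    (hτm : τ ≤ m) {A : Matrix I J (ZMod 2)[X]}
    (hA : ∀ i j, (A i j).degree < (m : WithBot ℕ))
    {v : I × Fin (m - τ) → ZMod 2} (hv : Matrix.vecMul v (Tmap m τ A) = 0) (j : J) :
    ∃ w : (ZMod 2)[X], w.degree < (τ : WithBot ℕ) ∧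
      (X ^ m + 1 : (ZMod 2)[X]) ∣
        ∑ i, (∑ k : Fin (m - τ), C (v (i, k)) * X ^ (k : ℕ)) * A i j - X ^ (m - τ) * w := by
  set c : ℕ → ZMod 2 := fun t =>
    ∑ i, ∑ k : Fin (m - τ), v (i, k) * (A i j).coeff ((t + (m - k)) % m) with hc
  have hc0 : ∀ t < m - τ, c t = 0 := by
    intro t ht
    have h := congrFun hv (j, ⟨t, ht⟩)
    simpa [Matrix.vecMul, dotProduct, Tmap, Att, Fintype.sum_prod_type, hc] using h
  refine ⟨∑ l : Fin τ, C (c (m - τ + l)) * X ^ (l : ℕ), degree_sum_fin_lt _, ?_⟩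
  rw [← Ideal.mem_span_singleton, ← Ideal.Quotient.eq_zero_iff_mem, map_sub, sub_eq_zero]
  set F := Ideal.Quotient.mk (Ideal.span {(X ^ m + 1 : (ZMod 2)[X])}) with hF
  have hX : F X ^ m = 1 := by
    rw [← sub_eq_zero, ← map_pow, ← map_one F, ← map_sub, ← X_pow_add_one_eq_sub_one,
      Ideal.Quotient.eq_zero_iff_mem]
    exact Ideal.mem_span_singleton_self _
  have hR : F (X ^ (m - τ) * ∑ l : Fin τ, C (c (m - τ + l)) * X ^ (l : ℕ)) =
      ∑ t ∈ Finset.range m, F (C (c t)) * F X ^ t := by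
    obtain ⟨M, rfl⟩ : ∃ M, m = M + τ := ⟨m - τ, by omega⟩
    rw [Finset.sum_range_add, Finset.sum_eq_zero (s := Finset.range M), zero_add,
      Finset.sum_range, map_mul, map_sum, Finset.mul_sum]
    · refine Finset.sum_congr rfl fun l _ => ?_
      simp only [map_mul, map_pow, Nat.add_sub_cancel, pow_add]
      ring
    · intro t ht
      rw [hc0 t (by simpa using ht)]
      simp
  rw [hR, map_sum]
  simp only [map_mul, map_sum, hc, Finset.sum_mul, map_pow]
  conv_rhs => rw [Finset.sum_comm]
  refine Finset.sum_congr rfl fun i _ => ?_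
  conv_rhs => rw [Finset.sum_comm]
  refine Finset.sum_congr rfl fun k _ => ?_
  rw [mul_assoc, pow_mul_map_eq_sum F (by omega) hX (hA i j), Finset.mul_sum]
  refine Finset.sum_congr rfl fun t _ => ?_
  rw [mul_assoc]

theorem stmt8 (p s τ m : ℕ) (hp : 1 < p) (hodd : Odd p)
    (hτ : τ = 2 ^ s) (hm : m = p * τ)
    (r n : ℕ) (hr : 2 ≤ r) (hrn : r < n)
    (H : Matrix (Fin r) (Fin n) (Polynomial (ZMod 2)))
    (hdeg : ∀ i j, (H i j).degree < (m : WithBot ℕ))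
    (hrow0 : ∀ j : Fin n, H ⟨0, by omega⟩ j = 1)
    (hMDS : ∀ φ : Fin r → Fin n, Function.Injective φ →
      IsCoprime (H.submatrix id φ).det (fpoly p τ))
    (hgcd : ∀ (i : Fin r) (j k : Fin n), 1 ≤ i.1 → j ≠ k →
      EuclideanDomain.gcd (H i j) (X ^ m + 1 : Polynomial (ZMod 2)) = X ^ τ + 1 ∨
      EuclideanDomain.gcd (H i j + H i k) (X ^ m + 1 : Polynomial (ZMod 2)) = X ^ τ + 1) :
    ∀ φ : Fin r → Fin n, Function.Injective φ →
      IsUnit (Tmap m τ (H.submatrix id φ)) := by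
  intro φ hφ
  have hτ0 : 0 < τ := hτ ▸ by positivity
  have hτm : τ ≤ m := hm ▸ Nat.le_mul_of_pos_left τ (by omega)
  have hm0 : 0 < m := by omega
  have hfact := fpoly_mul_X_pow_add_one p τ
  have hfdeg := degree_fpoly (p := p) (by omega) hτ0
  rw [← hm] at hfact hfdeg
  have hfm : fpoly p τ ∣ X ^ m + 1 := ⟨_, hfact.symm⟩
  have hgm : (X ^ τ + 1 : (ZMod 2)[X]) ∣ X ^ m + 1 := ⟨_, by rw [← hfact, mul_comm]⟩
  have hgM : (X ^ τ + 1 : (ZMod 2)[X]) ∣ X ^ (m - τ) - 1 := by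
    rw [← X_pow_add_one_eq_sub_one, show m - τ = (p - 1) * τ by rw [hm, Nat.sub_mul, one_mul],
      ← fpoly_mul_X_pow_add_one]
    exact dvd_mul_left _ _
  set i₀ : Fin r := ⟨0, by omega⟩ with hi₀
  set A := H.submatrix id φ with hA
  have hA0 : ∀ j, A i₀ j = 1 := fun j => hrow0 (φ j)
  have hAg : ∀ i j k, (X ^ τ + 1 : (ZMod 2)[X]) ∣ A i j - A i k := by
    intro i j k
    rcases eq_or_ne i i₀ with rfl | hi
    · simp [hA0]
    · refine dvd_sub_of_forall_dvd_or_dvd_add (h := H i) (fun j k hjk => ?_) (φ j) (φ k)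
      have hi1 : 1 ≤ i.1 := by
        rw [Nat.one_le_iff_ne_zero]
        exact fun h => hi (Fin.ext h)
      refine (hgcd i j k hi1 hjk).imp (fun h => ?_) (fun h => ?_) <;>
      · rw [← h]
        exact EuclideanDomain.gcd_dvd_left _ _
  rw [← Matrix.vecMul_injective_iff_isUnit]
  refine (injective_iff_map_eq_zero (Matrix.vecMulLinear (Tmap m τ A))).2 fun v hv => ?_
  choose w hw hwd using
    exists_X_pow_mul_of_vecMul_Tmap_eq_zero hτm (fun i j => hdeg i (φ j)) hv
  set V : Fin r → (ZMod 2)[X] := fun i => ∑ k : Fin (m - τ), C (v (i, k)) * X ^ (k : ℕ) with hV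
  have hVdeg : ∀ i, (V i).degree < ((m - τ : ℕ) : WithBot ℕ) := fun i => degree_sum_fin_lt _
  have hwd' : ∀ j, (X ^ m + 1 : (ZMod 2)[X]) ∣ ∑ i, V i * A i j - X ^ (m - τ) * w j := hwd
  have hwc : ∀ j, w j = w i₀ := by
    intro j
    have h1 : (X ^ τ + 1 : (ZMod 2)[X]) ∣ ∑ i, V i * A i j - ∑ i, V i * A i i₀ := by
      rw [← Finset.sum_sub_distrib]
      refine Finset.dvd_sum fun i _ => ?_
      rw [← mul_sub]
      exact (hAg i j i₀).mul_left _
    have h2 : (X ^ τ + 1 : (ZMod 2)[X]) ∣ w j - w i₀ := by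
      have h3 := dvd_sub (dvd_add (dvd_sub h1 (hgm.trans (hwd' j))) (hgm.trans (hwd' i₀)))
        (hgM.mul_right (w j - w i₀))
      convert h3 using 1
      ring
    refine sub_eq_zero.1 (eq_zero_of_dvd_of_degree_lt h2 ?_)
    rw [degree_X_pow_add_one hτ0]
    exact (degree_sub_le _ _).trans_lt (max_lt (hw j) (hw i₀))
  have hU := dvd_of_dvd_vecMul_of_isCoprime_det (A := A) (f := fpoly p τ) (hMDS φ hφ)
    (u := V - Pi.single i₀ (X ^ (m - τ) * w i₀)) (fun j => by
      rw [Matrix.sub_vecMul, Matrix.single_vecMul]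
      refine hfm.trans ?_
      have h := hwd' j
      rw [hwc j] at h
      simpa [Matrix.vecMul, dotProduct, hA0] using h)
  have hV1 : ∀ i, i ≠ i₀ → V i = 0 := by
    intro i hi
    have h := hU i
    simp only [Pi.sub_apply, Pi.single_eq_of_ne hi, sub_zero] at h
    exact eq_zero_of_dvd_of_degree_lt h (hfdeg ▸ hVdeg i)
  have hV0 : V i₀ = 0 := by
    have h := hwd' i₀
    rw [Finset.sum_eq_single i₀ (fun i _ hi => by rw [hV1 i hi, zero_mul]) (by simp), hA0,
      mul_one] at h
    have hlt : (X ^ (m - τ) * w i₀).degree < (m : WithBot ℕ) := by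
      rcases eq_or_ne (w i₀) 0 with h0 | h0
      · simp [h0]
      · have h1 := hw i₀
        rw [degree_mul, degree_X_pow, degree_eq_natDegree h0] at *
        norm_cast at *
        omega
    have hVlt : (V i₀).degree < (m : WithBot ℕ) :=
      (hVdeg i₀).trans_le (by exact_mod_cast Nat.sub_le m τ)
    have h2 : V i₀ = X ^ (m - τ) * w i₀ := by
      refine sub_eq_zero.1 (eq_zero_of_dvd_of_degree_lt h ?_)
      rw [degree_X_pow_add_one hm0]
      exact (degree_sub_le _ _).trans_lt (max_lt hVlt hlt)
    refine eq_zero_of_dvd_of_degree_lt (p := X ^ (m - τ)) ⟨_, h2⟩ ?_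
    rw [degree_X_pow]
    exact hVdeg i₀
  ext ⟨i, k⟩
  have hVi : V i = 0 := by
    rcases eq_or_ne i i₀ with rfl | hi
    · exact hV0
    · exact hV1 i hi
  have h := congrArg (fun q => coeff q k) hVi
  simpa [hV, finsetSum_coeff, coeff_C_mul, coeff_X_pow, Fin.val_inj] using h
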